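/- arXiv:1102.3205 — 2 statements merged into one kernel-verified Lean document; each statement's English description precedes it below -/
import Mathlib

section
/- Let F be a differential field of characteristic zero with field of constants C, let f₁, …, fₙ ∈ F satisfy condition (C), and let F ⊆ E be an extension of differential fields with E = F(x_{i,j} : 1 ≤ i ≤ n, 1 ≤ j ≤ n+1−i), where the x_{i,j} are algebraically independent over F and x_{1,j}′ = f_j, x_{i,j}′ = f_j · x_{i−1, j+1} for 2 ≤ i ≤ n. Then every constant of E lies in C; that is, E is a no new constants extension of F. -/
namespace MvPolynomial

noncomputable section

/-- The derivation of `MvPolynomial σ K` that applies a derivation of `K` to every coefficient. -/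
def coeffDerivation {σ K : Type*} [CommRing K] (d : Derivation ℤ K K) :
    Derivation ℤ (MvPolynomial σ K) (MvPolynomial σ K) :=
  Derivation.mk' (AddMonoidHom.toIntLinearMap
    { toFun := fun p => AddMonoidAlgebra.map (d : K →+ K) p
      map_zero' := by ext m; simp
      map_add' := fun p q => by ext m; simp }) <| fun p q => by
    classical
    ext m
    rw [smul_eq_mul, smul_eq_mul, mul_comm q]
    simp [coeff_mul, Finset.sum_add_distrib]
    simp only [mul_comm]

@[simp]
theorem coeff_coeffDerivation {σ K : Type*} [CommRing K] (d : Derivation ℤ K K)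
    (p : MvPolynomial σ K) (m : σ →₀ ℕ) :
    coeff m (coeffDerivation d p) = d (coeff m p) := rfl

@[simp]
theorem coeffDerivation_C {σ K : Type*} [CommRing K] (d : Derivation ℤ K K) (a : K) :
    coeffDerivation d (C a : MvPolynomial σ K) = C (d a) := by
  classical
  ext m
  rw [coeff_coeffDerivation, coeff_C, coeff_C]
  split_ifs <;> simp

@[simp]
theorem coeffDerivation_X {σ K : Type*} [CommRing K] (d : Derivation ℤ K K) (i : σ) :
    coeffDerivation d (X i : MvPolynomial σ K) = 0 := by
  classical
  ext m
  rw [coeff_coeffDerivation, coeff_X]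
  split_ifs <;> simp

/-- The derivation of `MvPolynomial σ K` that extends `d` and sends `X i` to `g i`. -/
def extendDerivation {σ K : Type*} [CommRing K] (d : Derivation ℤ K K)
    (g : σ → MvPolynomial σ K) : Derivation ℤ (MvPolynomial σ K) (MvPolynomial σ K) :=
  coeffDerivation d + (mkDerivation K g).restrictScalars ℤ

theorem extendDerivation_apply {σ K : Type*} [CommRing K] (d : Derivation ℤ K K)
    (g : σ → MvPolynomial σ K) (p : MvPolynomial σ K) :
    extendDerivation d g p = coeffDerivation d p + mkDerivation K g p := rfl

@[simp]
theorem extendDerivation_C {σ K : Type*} [CommRing K] (d : Derivation ℤ K K)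
    (g : σ → MvPolynomial σ K) (a : K) : extendDerivation d g (C a) = C (d a) := by
  simp [extendDerivation_apply]

@[simp]
theorem extendDerivation_X {σ K : Type*} [CommRing K] (d : Derivation ℤ K K)
    (g : σ → MvPolynomial σ K) (i : σ) : extendDerivation d g (X i) = g i := by
  simp [extendDerivation_apply]

/-- A ring derivation of a polynomial ring that vanishes on coefficients and variables is zero. -/
theorem intDerivation_eq_zero {σ K : Type*} [CommRing K]
    (d : Derivation ℤ (MvPolynomial σ K) (MvPolynomial σ K))
    (hC : ∀ a, d (C a) = 0) (hX : ∀ i, d (X i) = 0) (p : MvPolynomial σ K) : d p = 0 := by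
  induction p using MvPolynomial.induction_on with
  | C a => exact hC a
  | add p q hp hq => rw [map_add, hp, hq, add_zero]
  | mul_X p i hp => rw [Derivation.leibniz, hp, hX, smul_zero, smul_zero, add_zero]

/-- The polynomials all of whose monomials have weight less than `d`. -/
def weightLT {σ : Type*} (K : Type*) [CommRing K] (w : σ → ℕ) (d : ℕ) :
    Submodule K (MvPolynomial σ K) where
  carrier := {p | ∀ m, d ≤ Finsupp.weight w m → coeff m p = 0}
  zero_mem' := fun m _ => coeff_zero m
  add_mem' := fun hp hq m hm => by rw [coeff_add, hp m hm, hq m hm, add_zero]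
  smul_mem' := fun a p hp m hm => by rw [coeff_smul, hp m hm, smul_zero]

/-- A derivation lowering the weight of each variable lowers the weight of each polynomial. -/
theorem mkDerivation_mem_weightLT {σ K : Type*} [CommRing K] {w : σ → ℕ}
    {g : σ → MvPolynomial σ K} (hg : ∀ i, g i ∈ weightLT K w (w i)) {d : ℕ}
    {p : MvPolynomial σ K} (hp : p ∈ weightLT K w (d + 1)) :
    mkDerivation K g p ∈ weightLT K w d := by
  classical
  rw [p.as_sum, map_sum]
  refine Submodule.sum_mem _ fun m hm => ?_
  have hmd : Finsupp.weight w m ≤ d := by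
    by_contra! h
    exact (mem_support_iff.mp hm) (hp m h)
  rw [mkDerivation_monomial]
  refine Submodule.smul_mem _ _ (Submodule.sum_mem _ fun i hi => ?_)
  intro m' hm'
  dsimp only
  rw [smul_eq_mul, coeff_monomial_mul']
  split_ifs with hle
  · have hi' : m i ≠ 0 := Finsupp.mem_support_iff.mp hi
    have h1 : Finsupp.weight w (m - Finsupp.single i 1) + w i = Finsupp.weight w m :=
      Finsupp.weight_sub_single_add hi'
    have h2 : Finsupp.weight w (m' - (m - Finsupp.single i 1))
        + Finsupp.weight w (m - Finsupp.single i 1) = Finsupp.weight w m' := by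
      rw [← map_add, tsub_add_cancel_of_le hle]
    rw [hg i _ (by omega), mul_zero]
  · rfl

theorem exists_mem_weightLT {σ K : Type*} [CommRing K] (w : σ → ℕ) (p : MvPolynomial σ K) :
    ∃ d, p ∈ weightLT K w d := by
  refine ⟨p.support.sup (Finsupp.weight w) + 1, fun m hm => ?_⟩
  by_contra h
  have := Finset.le_sup (f := Finsupp.weight w) (mem_support_iff.mpr h)
  omega

theorem eq_C_of_forall_pderiv_eq_zero {σ K : Type*} [Field K] [CharZero K]
    {p : MvPolynomial σ K} (hp : ∀ i, pderiv i p = 0) : p = C (coeff 0 p) := by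
  classical
  ext m
  rw [coeff_C]
  split_ifs with h
  · rw [h]
  · obtain ⟨i, hi⟩ := Finsupp.ne_iff.mp (Ne.symm h)
    have hle : Finsupp.single i 1 ≤ m := Finsupp.single_le_iff.mpr (Nat.one_le_iff_ne_zero.mpr hi)
    have := coeff_pderiv (i := i) p (m - Finsupp.single i 1)
    rw [hp, coeff_zero, tsub_add_cancel_of_le hle] at this
    exact (mul_eq_zero.mp this.symm).resolve_right (Nat.cast_add_one_ne_zero _)

theorem mkDerivation_eq_sum_pderiv {σ K : Type*} [Fintype σ] [CommRing K]
    (g : σ → MvPolynomial σ K) (p : MvPolynomial σ K) :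
    mkDerivation K g p = ∑ i, g i * pderiv i p := by
  classical
  induction p using MvPolynomial.induction_on with
  | C a => simp
  | add p q hp hq => simp only [map_add, hp, hq, mul_add, Finset.sum_add_distrib]
  | mul_X p j hp =>
    have h : ∑ i, p * (g i * pderiv i (X j)) = p * g j := by
      rw [Finset.sum_eq_single j (fun i _ hij => by rw [pderiv_X_of_ne hij.symm]; simp) (by simp),
        pderiv_X_self, mul_one]
    simp only [Derivation.leibniz, smul_eq_mul, mul_add, Finset.sum_add_distrib, mkDerivation_X, hp,
      Finset.mul_sum, mul_left_comm, h]

/-- If a derivation extending one of `K` lowers the weight of each variable, then each nonzero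
subspace stable under it contains a nonzero constant. -/
theorem exists_ne_zero_extendDerivation_eq_zero {σ K : Type*} [Countable σ] [Field K]
    (d : Derivation ℤ K K) {w : σ → ℕ} {g : σ → MvPolynomial σ K}
    (hg : ∀ i, g i ∈ weightLT K w (w i)) (I : Submodule K (MvPolynomial σ K))
    (hI : ∀ p ∈ I, extendDerivation d g p ∈ I) (hne : ∃ p ∈ I, p ≠ 0) :
    ∃ p ∈ I, p ≠ 0 ∧ extendDerivation d g p = 0 := by
  classical
  obtain ⟨e, he⟩ := exists_injective_nat (σ →₀ ℕ)
  let rank : (σ →₀ ℕ) → ℕ ×ₗ ℕ := fun m => toLex (Finsupp.weight w m, e m)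
  have hrank : Function.Injective rank := fun a b h =>
    he (by simpa [rank] using congrArg (fun z => (ofLex z).2) h)
  let S : Set (ℕ ×ₗ ℕ) := {r | ∃ p ∈ I, ∃ m ∈ p.support, rank m = r ∧
    ∀ m' ∈ p.support, rank m' ≤ r}
  have hS : ∀ p ∈ I, p ≠ 0 → ∃ m ∈ p.support, rank m ∈ S ∧ ∀ m' ∈ p.support, rank m' ≤ rank m := by
    intro p hp h0
    obtain ⟨m, hm, hmax⟩ := p.support.exists_max_image rank (support_nonempty.mpr h0)
    exact ⟨m, hm, ⟨p, hp, m, hm, rfl, hmax⟩, hmax⟩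
  obtain ⟨p₀, hp₀, h0⟩ := hne
  obtain ⟨m₀, -, hm₀, -⟩ := hS p₀ hp₀ h0
  obtain ⟨r, ⟨q, hq, m, hm, rfl, hmax⟩, hmin⟩ := wellFounded_lt.has_min S ⟨_, hm₀⟩
  have hqm : coeff m q ≠ 0 := mem_support_iff.mp hm
  set p := (coeff m q)⁻¹ • q with hpdef
  have hpI : p ∈ I := I.smul_mem _ hq
  have hpm : coeff m p = 1 := by rw [hpdef, coeff_smul, smul_eq_mul, inv_mul_cancel₀ hqm]
  have hpmax : ∀ m', coeff m' p ≠ 0 → rank m' ≤ rank m := by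
    intro m' h
    refine hmax m' (mem_support_iff.mpr fun h' => h ?_)
    rw [hpdef, coeff_smul, h', smul_zero]
  refine ⟨p, hpI, fun h => by simp [h] at hpm, ?_⟩
  by_contra hD
  obtain ⟨m', hm', hm'S, -⟩ := hS _ (hI p hpI) hD
  refine hmin _ hm'S (lt_of_le_of_ne ?_ ?_)
  all_goals
    have hpw : p ∈ weightLT K w (Finsupp.weight w m + 1) := by
      intro m'' h''
      by_contra h
      have := hpmax m'' h
      simp only [rank, Prod.Lex.toLex_le_toLex] at this
      omega
    have hlow := mkDerivation_mem_weightLT hg hpw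
    rw [mem_support_iff, extendDerivation_apply, coeff_add, coeff_coeffDerivation] at hm'
  · by_contra! hlt
    have hc : coeff m' p = 0 := by
      by_contra h
      exact absurd (hpmax m' h) (not_le.mpr hlt)
    refine hm' ?_
    rw [hc, map_zero, zero_add]
    refine hlow m' ?_
    simp only [rank, Prod.Lex.toLex_lt_toLex] at hlt
    omega
  · intro h
    rw [hrank h, hpm, Derivation.map_one_eq_zero, zero_add] at hm'
    exact hm' (hlow m le_rfl)

end

end MvPolynomial

namespace IteratedIntegral

open MvPolynomial

noncomputable section

/-- The index set of the variables `x_{i,j}`. -/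
abbrev Index (n : ℕ) : Type := {p : ℕ × ℕ // 1 ≤ p.1 ∧ 1 ≤ p.2 ∧ p.1 + p.2 ≤ n + 1}

instance (n : ℕ) : Finite (Index n) :=
  Set.Finite.subset (Set.finite_Icc (1, 1) (n, n)) fun p hp => by
    obtain ⟨h1, h2, h3⟩ := hp
    exact ⟨⟨h1, h2⟩, ⟨by dsimp only; omega, by dsimp only; omega⟩⟩

/-- The weight of `x_{i,j}` is its level `i`. -/
def level {n : ℕ} (s : Index n) : ℕ := s.1.1

/-- The entries of the generic unipotent upper triangular matrix of size `n + 1`: the entry in row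
`j` and column `k` is the variable `x_{k-j,j}` above the diagonal. -/
def entry (K : Type*) [CommRing K] (n j k : ℕ) : MvPolynomial (Index n) K :=
  if h : 1 ≤ j ∧ j < k ∧ k ≤ n + 1 then
    X ⟨(k - j, j), by dsimp only; omega, h.1, by dsimp only; omega⟩
  else if j = k then 1 else 0

variable {K : Type*} [CommRing K] {n : ℕ}

theorem entry_index (s : Index n) : entry K n s.1.2 (s.1.1 + s.1.2) = X s := by
  obtain ⟨⟨i, j⟩, h1, h2, h3⟩ := s
  dsimp only at *
  rw [entry, dif_pos ⟨h2, by omega, h3⟩]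
  congr 3
  omega

@[simp]
theorem entry_self (j : ℕ) : entry K n j j = 1 := by
  rw [entry, dif_neg (by omega), if_pos rfl]

theorem entry_of_lt {j k : ℕ} (h : k < j) : entry K n j k = 0 := by
  rw [entry, dif_neg (by omega), if_neg (by omega)]

/-- An identity of entries holds once it holds for variables, for the diagonal and below it. -/
theorem entry_cases {P : ℕ → ℕ → MvPolynomial (Index n) K → Prop}
    (hX : ∀ s : Index n, P s.1.2 (s.1.1 + s.1.2) (X s)) (h1 : ∀ j, P j j 1)
    (h0 : ∀ j k, k < j → P j k 0) {j k : ℕ} (hj : 1 ≤ j) (hk : k ≤ n + 1) :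
    P j k (entry K n j k) := by
  rcases lt_trichotomy j k with h | rfl | h
  · have := hX ⟨(k - j, j), by dsimp only; omega, hj, by dsimp only; omega⟩
    rw [← entry_index] at this
    dsimp only at this
    rwa [Nat.sub_add_cancel h.le] at this
  · rw [entry_self]; exact h1 j
  · rw [entry_of_lt h]; exact h0 j k h

theorem entry_mem_weightLT {j k d : ℕ} (hj : 1 ≤ j) (hk : k ≤ n + 1) (hd : 0 < d)
    (hkd : k < j + d) : entry K n j k ∈ weightLT K level d := by
  classical
  refine entry_cases (P := fun j k p => k < j + d → p ∈ weightLT K level d)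
    (fun s h m hm => ?_) (fun j _ m hm => ?_) (fun _ _ _ _ => zero_mem _) hj hk hkd
  · rw [coeff_X, if_neg]
    rintro rfl
    rw [Finsupp.weight_single, smul_eq_mul, one_mul, level] at hm
    omega
  · rw [coeff_one, if_neg]
    rintro rfl
    rw [map_zero] at hm
    omega

/-- The derivation `Y ↦ Y E_{a,b}` of the coordinate ring of unipotent matrices. -/
def colDerivation (K : Type*) [CommRing K] (n a b : ℕ) :
    Derivation K (MvPolynomial (Index n) K) (MvPolynomial (Index n) K) :=
  mkDerivation K fun s => if s.1.1 + s.1.2 = b then entry K n s.1.2 a else 0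

theorem colDerivation_entry {a b j k : ℕ} (hab : a < b) (hj : 1 ≤ j) (hk : k ≤ n + 1) :
    colDerivation K n a b (entry K n j k) = if k = b then entry K n j a else 0 := by
  refine entry_cases (P := fun j k p =>
    colDerivation K n a b p = if k = b then entry K n j a else 0)
    (fun s => mkDerivation_X K _ s) (fun j => ?_) (fun j k h => ?_) hj hk
  · rw [Derivation.map_one_eq_zero]
    split_ifs with h
    · rw [entry_of_lt (by omega)]
    · rfl
  · rw [map_zero]
    split_ifs with h
    · rw [entry_of_lt (by omega)]
    · rfl

theorem colDerivation_mem_weightLT {a b d : ℕ} (hab : a < b) {p : MvPolynomial (Index n) K}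
    (hp : p ∈ weightLT K level (d + 1)) : colDerivation K n a b p ∈ weightLT K level d := by
  refine mkDerivation_mem_weightLT (fun s => ?_) hp
  have := s.2
  split_ifs with h
  · exact entry_mem_weightLT (by omega) (by omega) (by unfold level; omega) (by unfold level; omega)
  · exact zero_mem _

theorem colDerivation_bracket {a b c : ℕ} (hab : a < b) (hbc : b < c) (hc : c ≤ n + 1) :
    ⁅colDerivation K n a b, colDerivation K n b c⁆ = colDerivation K n a c := by
  ext1 s
  have := s.2
  rw [Derivation.commutator_apply, ← entry_index s,
    colDerivation_entry hab (by omega) (by omega),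
    colDerivation_entry hbc (by omega) (by omega),
    colDerivation_entry (hab.trans hbc) (by omega) (by omega)]
  split_ifs with h1 h2 h2
  · omega
  · rw [colDerivation_entry hab (by omega) (by omega), if_pos rfl, map_zero, sub_zero]
  · rw [colDerivation_entry hbc (by omega) (by omega), if_neg (by omega), map_zero, sub_zero]
  · rw [map_zero, map_zero, sub_zero]

/-- The images of the variables under the derivation `Y' = A Y`, where `A` has the entries `f j`
just above the diagonal. -/
def rowImage (f : ℕ → K) (s : Index n) : MvPolynomial (Index n) K :=
  C (f s.1.2) * entry K n (s.1.2 + 1) (s.1.1 + s.1.2)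

theorem rowImage_mem_weightLT (f : ℕ → K) (s : Index n) :
    rowImage f s ∈ weightLT K level (level s) := by
  have := s.2
  rw [rowImage, C_mul']
  exact Submodule.smul_mem _ _
    (entry_mem_weightLT (by omega) (by omega) (by unfold level; omega) (by unfold level; omega))

variable (d : Derivation ℤ K K) (f : ℕ → K)

theorem extendDerivation_entry {j k : ℕ} (hj : 1 ≤ j) (hk : k ≤ n + 1) :
    extendDerivation d (rowImage f) (entry K n j k) = C (f j) * entry K n (j + 1) k := by
  refine entry_cases (P := fun j k p =>
    extendDerivation d (rowImage f) p = C (f j) * entry K n (j + 1) k)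
    (fun s => extendDerivation_X d _ s) (fun j => ?_) (fun j k h => ?_) hj hk
  · rw [Derivation.map_one_eq_zero, entry_of_lt (by omega), mul_zero]
  · rw [map_zero, entry_of_lt (by omega), mul_zero]

theorem extendDerivation_colDerivation {a b : ℕ} (hab : a < b) (hb : b ≤ n + 1)
    (p : MvPolynomial (Index n) K) :
    extendDerivation d (rowImage f) (colDerivation K n a b p) =
      colDerivation K n a b (extendDerivation d (rowImage f) p) := by
  rw [← sub_eq_zero]
  refine intDerivation_eq_zero
    ⁅extendDerivation d (rowImage (n := n) f), (colDerivation K n a b).restrictScalars ℤ⁆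
    (fun a => ?_) (fun s => ?_) p
  · simp [Derivation.commutator_apply]
  · have := s.2
    rw [Derivation.commutator_apply, Derivation.restrictScalars_apply,
      Derivation.restrictScalars_apply, ← entry_index s,
      colDerivation_entry hab (by omega) (by omega),
      extendDerivation_entry d f (by omega) (by omega), C_mul', Derivation.map_smul,
      colDerivation_entry hab (by omega) (by omega)]
    split_ifs with h
    · rw [extendDerivation_entry d f (by omega) (by omega), C_mul', sub_self]
    · rw [map_zero, smul_zero, sub_self]

theorem pderiv_eq_zero_of_colDerivation {p : MvPolynomial (Index n) K}
    (hp : ∀ a b, 1 ≤ a → a < b → b ≤ n + 1 → colDerivation K n a b p = 0) (s : Index n) :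
    pderiv s p = 0 := by
  classical
  have := Fintype.ofFinite (Index n)
  induction hj : s.1.2 using Nat.strong_induction_on generalizing s with
  | _ j ih =>
    have hs := s.2
    have h := hp s.1.2 (s.1.1 + s.1.2) hs.2.1 (by omega) hs.2.2
    rw [colDerivation, mkDerivation_eq_sum_pderiv,
      Finset.sum_eq_single s (fun t _ hts => ?_) (by simp)] at h
    · simpa using h
    · split_ifs with hcol
      · rcases lt_trichotomy t.1.2 s.1.2 with hlt | heq | hgt
        · rw [ih _ (hj ▸ hlt) t rfl, mul_zero]
        · exact absurd (Subtype.ext (Prod.ext (by omega) heq)) hts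
        · rw [entry_of_lt hgt, zero_mul]
      · rw [zero_mul]

end

/-- The constants of the polynomial ring in the `x_{i,j}` lie in the base field. -/
theorem eq_C_of_extendDerivation_eq_zero {K : Type*} [Field K] [CharZero K] {n : ℕ}
    (d : Derivation ℤ K K) (f : ℕ → K)
    (hf : ∀ (c : ℕ → K) (g : K), (∀ j, 1 ≤ j → j ≤ n → d (c j) = 0) →
      ∑ j ∈ Finset.Icc 1 n, c j * f j = d g → ∀ j, 1 ≤ j → j ≤ n → c j = 0)
    {p : MvPolynomial (Index n) K} (hp : extendDerivation d (rowImage f) p = 0) :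
    ∃ a, p = C a := by
  obtain ⟨N, hN⟩ := exists_mem_weightLT level p
  induction N generalizing p with
  | zero => exact ⟨0, by ext m; rw [hN m (Nat.zero_le _), C_0, coeff_zero]⟩
  | succ N ih =>
    have hcol : ∀ a b, a < b → b ≤ n + 1 → ∃ c, colDerivation K n a b p = C c := fun a b hab hb =>
      ih (by rw [extendDerivation_colDerivation d f hab hb, hp, map_zero])
        (colDerivation_mem_weightLT hab hN)
    have hex : ∀ a, ∃ c, a ≤ n → colDerivation K n a (a + 1) p = C c := fun a => by
      by_cases h : a ≤ n
      · exact (hcol a (a + 1) (by omega) (by omega)).imp fun _ hc _ => hc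
      · exact ⟨0, fun h' => absurd h' h⟩
    choose c hc using hex
    have hdc : ∀ a, a ≤ n → d (c a) = 0 := fun a ha => by
      have := extendDerivation_colDerivation d f (Nat.lt_succ_self a) (Nat.succ_le_succ ha) p
      rw [hc a ha, hp, map_zero, extendDerivation_C] at this
      exact C_eq_zero.mp this
    let q := p - ∑ k ∈ Finset.Icc 1 n, C (c k) * entry K n k (k + 1)
    have hq : q = C (coeff 0 q) := by
      refine eq_C_of_forall_pderiv_eq_zero (pderiv_eq_zero_of_colDerivation ?_)
      intro a b ha hab hb
      have hsum : ∀ k ∈ Finset.Icc 1 n, colDerivation K n a b (C (c k) * entry K n k (k + 1)) =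
          if k + 1 = b then c k • entry K n k a else 0 := fun k hk => by
        rw [Finset.mem_Icc] at hk
        rw [C_mul', Derivation.map_smul, colDerivation_entry hab hk.1 (by omega)]
        split_ifs
        · rfl
        · rw [smul_zero]
      rw [map_sub, map_sum, Finset.sum_congr rfl hsum,
        Finset.sum_eq_single (b - 1) (fun k _ hk => if_neg (by omega))
          (fun h => absurd (Finset.mem_Icc.mpr ⟨by omega, by omega⟩) h), if_pos (by omega)]
      obtain rfl | hlt : b = a + 1 ∨ a + 1 < b := by omega
      · rw [hc a (by omega), Nat.add_sub_cancel, entry_self, smul_eq_C_mul, mul_one, sub_self]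
      · obtain ⟨c', hc'⟩ := hcol (a + 1) b hlt hb
        rw [entry_of_lt (by omega), smul_zero, sub_zero,
          ← colDerivation_bracket (Nat.lt_succ_self a) hlt hb, Derivation.commutator_apply,
          hc a (by omega), hc', derivation_C, derivation_C, sub_zero]
    have hdq : ∑ k ∈ Finset.Icc 1 n, c k * f k = d (-coeff 0 q) := by
      apply C_injective (Index n) K
      rw [map_neg, map_neg, ← extendDerivation_C d (rowImage f), ← hq]
      simp only [q, map_sub, hp, map_sum, zero_sub, neg_neg]
      refine Finset.sum_congr rfl fun k hk => ?_
      rw [Finset.mem_Icc] at hk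
      rw [Derivation.leibniz, extendDerivation_C, hdc k hk.2,
        extendDerivation_entry d f hk.1 (by omega), entry_self]
      simp
    have hc0 := hf c _ (fun j _ hj => hdc j hj) hdq
    refine ⟨coeff 0 q, ?_⟩
    rw [← hq, eq_comm, sub_eq_self]
    refine Finset.sum_eq_zero fun k hk => ?_
    rw [Finset.mem_Icc] at hk
    rw [hc0 k hk.1 hk.2, C_0, zero_mul]

end IteratedIntegral

/-- The extension `E = F(x_{i,j})` built from `f₁, …, fₙ`
satisfying condition (C) is a no new constants extension of `F`: every constant of `E`
lies in the constants of `F`. -/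
theorem no_new_constants_full
    (E : Type) [Field E] [CharZero E] (D : Derivation ℚ E E)
    (F : Subfield E) (hF : ∀ a ∈ F, D a ∈ F)
    (n : ℕ) (f : ℕ → E) (hf : ∀ j, 1 ≤ j → j ≤ n → f j ∈ F)
    (hcondC : ∀ (c : ℕ → E) (g : E),
      (∀ j, 1 ≤ j → j ≤ n → c j ∈ F ∧ D (c j) = 0) → g ∈ F →
      (∑ j ∈ Finset.Icc 1 n, c j * f j) = D g → ∀ j, 1 ≤ j → j ≤ n → c j = 0)
    (x : ℕ → ℕ → E)
    (hind : AlgebraicIndependent F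
      (fun p : {p : ℕ × ℕ // 1 ≤ p.1 ∧ 1 ≤ p.2 ∧ p.1 + p.2 ≤ n + 1} => x p.1.1 p.1.2))
    (hgen : Subfield.closure
      (↑F ∪ {a | ∃ i j, 1 ≤ i ∧ 1 ≤ j ∧ i + j ≤ n + 1 ∧ a = x i j}) = ⊤)
    (hd1 : ∀ j, 1 ≤ j → j ≤ n → D (x 1 j) = f j)
    (hdi : ∀ i j, 2 ≤ i → 1 ≤ j → i + j ≤ n + 1 → D (x i j) = f j * x (i - 1) (j + 1)) :
    ∀ c : E, D c = 0 → c ∈ F := by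
  classical
  intro c hc
  let d : Derivation ℤ F F := Derivation.mk' (AddMonoidHom.toIntLinearMap
    { toFun := fun a => ⟨D a, hF a a.2⟩
      map_zero' := Subtype.ext (map_zero D)
      map_add' := fun a b => Subtype.ext (map_add D (a : E) b) })
    fun a b => Subtype.ext (D.leibniz (a : E) b)
  have hd : ∀ a : F, (d a : E) = D (a : E) := fun a => rfl
  let f' : ℕ → F := fun j => if h : 1 ≤ j ∧ j ≤ n then ⟨f j, hf j h.1 h.2⟩ else 0
  have hf' : ∀ j, 1 ≤ j → j ≤ n → (f' j : E) = f j := fun j h1 h2 => by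
    simp only [f', dif_pos (And.intro h1 h2)]
  have hcond : ∀ (c : ℕ → F) (g : F), (∀ j, 1 ≤ j → j ≤ n → d (c j) = 0) →
      ∑ j ∈ Finset.Icc 1 n, c j * f' j = d g → ∀ j, 1 ≤ j → j ≤ n → c j = 0 := by
    intro c g hc hg j h1 h2
    refine Subtype.ext (hcondC (fun j => c j) g (fun j h1 h2 => ⟨(c j).2, ?_⟩) g.2 ?_ j h1 h2)
    · rw [← hd, hc j h1 h2]; rfl
    · rw [← hd, ← hg, AddSubmonoidClass.coe_finsetSum]
      refine Finset.sum_congr rfl fun j hj => ?_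
      rw [Finset.mem_Icc] at hj
      rw [← hf' j hj.1 hj.2]; rfl
  let φ : MvPolynomial (IteratedIntegral.Index n) F →ₐ[F] E :=
    MvPolynomial.aeval fun p => x p.1.1 p.1.2
  have hφ : Function.Injective φ := hind
  let δ := MvPolynomial.extendDerivation d (IteratedIntegral.rowImage (n := n) f')
  have hφC : ∀ a : F, φ (MvPolynomial.C a) = a := fun a => MvPolynomial.aeval_C _ a
  have hφX : ∀ s, φ (MvPolynomial.X s) = x s.1.1 s.1.2 := fun s => MvPolynomial.aeval_X _ s
  have hφD : ∀ p, φ (δ p) = D (φ p) := by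
    intro p
    induction p using MvPolynomial.induction_on with
    | C a => rw [MvPolynomial.extendDerivation_C, hφC, hφC, hd]
    | add p q hp hq => rw [map_add, map_add, map_add, map_add, hp, hq]
    | mul_X p s hp =>
      have hs := s.2
      have hX : φ (δ (MvPolynomial.X s)) = D (φ (MvPolynomial.X s)) := by
        rw [MvPolynomial.extendDerivation_X, IteratedIntegral.rowImage, map_mul, hφC, hφX,
          hf' _ (by omega) (by omega)]
        obtain h | h : s.1.1 = 1 ∨ 2 ≤ s.1.1 := by omega
        · rw [h, hd1 _ (by omega) (by omega), add_comm 1, IteratedIntegral.entry_self, map_one,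
            mul_one]
        · rw [hdi _ _ h (by omega) (by omega)]
          have := IteratedIntegral.entry_index (K := F) (n := n)
            ⟨(s.1.1 - 1, s.1.2 + 1), by dsimp only; omega, by dsimp only; omega,
              by dsimp only; omega⟩
          dsimp only at this
          rw [show s.1.1 + s.1.2 = s.1.1 - 1 + (s.1.2 + 1) by omega, this, hφX]
      rw [Derivation.leibniz, map_add, smul_eq_mul, smul_eq_mul, map_mul, map_mul, map_mul,
        Derivation.leibniz, hp, hX, smul_eq_mul, smul_eq_mul]
  have hrange : ∀ a ∈ Subring.closure
      (↑F ∪ {a | ∃ i j, 1 ≤ i ∧ 1 ≤ j ∧ i + j ≤ n + 1 ∧ a = x i j} : Set E), ∃ p, φ p = a := by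
    intro a ha
    refine (Subring.closure_le (t := φ.toRingHom.range)).mpr ?_ ha
    rintro a (ha | ⟨i, j, h1, h2, h3, rfl⟩)
    · exact ⟨MvPolynomial.C ⟨a, ha⟩, hφC _⟩
    · exact ⟨MvPolynomial.X ⟨(i, j), h1, h2, h3⟩, hφX _⟩
  have hconst : ∀ p, φ p = c → c ∈ F := by
    intro p hp
    have hδp : δ p = 0 := hφ (by rw [hφD, hp, hc, map_zero])
    obtain ⟨a, rfl⟩ := IteratedIntegral.eq_C_of_extendDerivation_eq_zero d f' hcond hδp
    rw [← hp, hφC]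
    exact a.2
  let I : Submodule F (MvPolynomial (IteratedIntegral.Index n) F) :=
    { carrier := {p | ∃ q, φ p * c = φ q}
      zero_mem' := ⟨0, by rw [map_zero, zero_mul]⟩
      add_mem' := fun ⟨q, hq⟩ ⟨q', hq'⟩ => ⟨q + q', by rw [map_add, map_add, add_mul, hq, hq']⟩
      smul_mem' := fun a p ⟨q, hq⟩ => ⟨a • q, by rw [map_smul, map_smul, smul_mul_assoc, hq]⟩ }
  have hI : ∀ p ∈ I, δ p ∈ I := by
    rintro p ⟨q, hq⟩
    refine ⟨δ q, ?_⟩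
    rw [hφD, hφD, ← hq, Derivation.leibniz, hc, smul_zero, zero_add, smul_eq_mul, mul_comm]
  have hne : ∃ p ∈ I, p ≠ 0 := by
    obtain ⟨a, ha, b, hb, hab⟩ := Subfield.mem_closure_iff.mp (hgen ▸ Subfield.mem_top c)
    obtain ⟨p, rfl⟩ := hrange a ha
    obtain ⟨q, rfl⟩ := hrange b hb
    by_cases hq : q = 0
    · refine ⟨1, ⟨0, ?_⟩, one_ne_zero⟩
      rw [← hab, hq, map_zero, div_zero, mul_zero]
    · refine ⟨q, ⟨p, ?_⟩, hq⟩
      rw [← hab, mul_div_cancel₀ _ ((map_ne_zero_iff φ hφ).mpr hq)]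
  obtain ⟨p, ⟨q, hq⟩, hp0, hδp⟩ := MvPolynomial.exists_ne_zero_extendDerivation_eq_zero d
    (IteratedIntegral.rowImage_mem_weightLT f') I hI hne
  obtain ⟨a, rfl⟩ := IteratedIntegral.eq_C_of_extendDerivation_eq_zero d f' hcond hδp
  have ha : (a : E) ≠ 0 := fun h =>
    hp0 (by rw [show a = 0 from Subtype.ext h, MvPolynomial.C_0])
  refine hconst (MvPolynomial.C a⁻¹ * q) ?_
  rw [map_mul, ← hq, hφC, hφC, Subfield.coe_inv, inv_mul_cancel_left₀ ha]
end

section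
/- Let F be a differential field of characteristic zero with field of constants C, let f₁, …, fₙ ∈ F satisfy condition (C), and let F ⊆ E be an extension of differential fields with E = F(x_{i,j} : 1 ≤ i ≤ n, 1 ≤ j ≤ n+1−i), where the x_{i,j} are algebraically independent over F and x_{1,j}′ = f_j, x_{i,j}′ = f_j · x_{i−1, j+1} for 2 ≤ i ≤ n. Let N be the subfield of E generated over F⟨x_{n,1}⟩ by x_{1,1}, …, x_{1,n}. If x ∈ N satisfies x′ ∈ F, then there exist constants c₁, …, cₙ ∈ C and f ∈ F such that x = Σᵢ cᵢ·x_{1,i} + f. Moreover, if in addition x ∈ F⟨x_{1,n}⟩, then cᵢ = 0 for all i ≤ n−1. -/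
/-- The smallest differential subfield of `E` (with respect to the derivation `D`)
containing the subfield `F` and the set `S`; written `F⟨S⟩` in the paper. -/
def diffAdjoin (E : Type) [Field E] [CharZero E] (D : Derivation ℚ E E)
    (F : Subfield E) (S : Set E) : Subfield E :=
  sInf {K : Subfield E | F ≤ K ∧ S ⊆ K ∧ ∀ a ∈ K, D a ∈ K}

namespace IteratedIntegral

open MvPolynomial

/-- The index set of the variables: pairs `(i, j)` with `1 ≤ i`, `1 ≤ j`, `i + j ≤ n + 1`. -/
abbrev Idx (n : ℕ) : Type :=
  {p : ℕ × ℕ // 1 ≤ p.1 ∧ 1 ≤ p.2 ∧ p.1 + p.2 ≤ n + 1}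

variable {k : Type*} [Field k] {n : ℕ}

variable (k n) in
/-- The variable of index `(i, j)`, extended by `1` for `i = 0` and by `0` at the other pairs. -/
noncomputable def var (i j : ℕ) : MvPolynomial (Idx n) k :=
  if i = 0 then 1 else if h : 1 ≤ i ∧ 1 ≤ j ∧ i + j ≤ n + 1 then X ⟨(i, j), h⟩ else 0

@[simp]
lemma var_zero (j : ℕ) : var k n 0 j = 1 := by simp [var]

lemma var_of_valid {i j : ℕ} (h : 1 ≤ i ∧ 1 ≤ j ∧ i + j ≤ n + 1) :
    var k n i j = X ⟨(i, j), h⟩ := by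
  have : i ≠ 0 := by omega
  simp [var, this, h]

variable (k) in
/-- The derivation that removes the suffix indexed by `w` from a variable, where `(i, j)` is
thought of as the word `j, j + 1, …, j + i - 1`. -/
noncomputable def removeSuffix (w : Idx n) :
    Derivation k (MvPolynomial (Idx n) k) (MvPolynomial (Idx n) k) :=
  mkDerivation k fun v =>
    if w.1.1 ≤ v.1.1 ∧ v.1.1 + v.1.2 = w.1.1 + w.1.2 then var k n (v.1.1 - w.1.1) v.1.2 else 0

lemma removeSuffix_X (w v : Idx n) : removeSuffix k w (X v) =
    if w.1.1 ≤ v.1.1 ∧ v.1.1 + v.1.2 = w.1.1 + w.1.2 then var k n (v.1.1 - w.1.1) v.1.2 else 0 :=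
  mkDerivation_X _ _ _

lemma removeSuffix_var (w : Idx n) {i j : ℕ} (hj : 1 ≤ j) (hij : i + j ≤ n + 1) :
    removeSuffix k w (var k n i j) =
      if w.1.1 ≤ i ∧ i + j = w.1.1 + w.1.2 then var k n (i - w.1.1) j else 0 := by
  have hw := w.2
  rcases Nat.eq_zero_or_pos i with rfl | hi
  · rw [if_neg (by omega), var_zero, Derivation.map_one_eq_zero]
  · rw [var_of_valid ⟨hi, hj, hij⟩, removeSuffix_X]

/-- Removing a suffix of length at least two is a commutator. -/
lemma removeSuffix_eq_commutator (w : Idx n) (hw : 2 ≤ w.1.1) :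
    removeSuffix k w =
      ⁅removeSuffix k (⟨(1, w.1.2), by have := w.2; simp only; omega⟩ : Idx n),
        removeSuffix k (⟨(w.1.1 - 1, w.1.2 + 1), by have := w.2; simp only; omega⟩ : Idx n)⁆ := by
  refine derivation_ext fun v => ?_
  obtain ⟨⟨i, l⟩, h1, h2, h3⟩ := w
  obtain ⟨⟨a, b⟩, h4, h5, h6⟩ := v
  simp only at *
  change 2 ≤ i at hw
  rw [Derivation.commutator_apply, removeSuffix_X, removeSuffix_X, removeSuffix_X]
  simp only
  have e1 : removeSuffix k (⟨(1, l), by simp only; omega⟩ : Idx n)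
      (if i - 1 ≤ a ∧ a + b = i - 1 + (l + 1) then var k n (a - (i - 1)) b else 0) =
      if i ≤ a ∧ a + b = i + l then var k n (a - i) b else 0 := by
    by_cases h : i - 1 ≤ a ∧ a + b = i - 1 + (l + 1)
    · rw [if_pos h, removeSuffix_var _ h5 (by omega)]
      simp only
      by_cases h' : i ≤ a ∧ a + b = i + l
      · rw [if_pos h', if_pos (by omega)]
        congr 1; omega
      · rw [if_neg h', if_neg (by omega)]
    · rw [if_neg h, if_neg (by omega), map_zero]
  have e2 : removeSuffix k (⟨(i - 1, l + 1), by simp only; omega⟩ : Idx n)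
      (if 1 ≤ a ∧ a + b = 1 + l then var k n (a - 1) b else 0) = 0 := by
    split_ifs with h
    · rw [removeSuffix_var _ h5 (by omega), if_neg (by simp only; omega)]
    · exact map_zero _
  rw [e1, e2, sub_zero]

/-- A polynomial killed by every word of `N` suffix removals. -/
def NilAt : ℕ → MvPolynomial (Idx n) k → Prop
  | 0, p => p = 0
  | N + 1, p => ∀ w, NilAt N (removeSuffix k w p)

lemma NilAt.zero (N : ℕ) : NilAt N (0 : MvPolynomial (Idx n) k) := by
  induction N with
  | zero => rfl
  | succ N ih => intro w; simpa using ih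

lemma NilAt.succ {N : ℕ} {p : MvPolynomial (Idx n) k} (h : NilAt N p) : NilAt (N + 1) p := by
  induction N generalizing p with
  | zero => cases h; exact NilAt.zero _
  | succ N ih => exact fun w => ih (h w)

lemma NilAt.mono {N M : ℕ} (hNM : N ≤ M) {p : MvPolynomial (Idx n) k} (h : NilAt N p) :
    NilAt M p := by
  induction hNM with
  | refl => exact h
  | step _ ih => exact ih.succ

lemma NilAt.add {N : ℕ} {p q : MvPolynomial (Idx n) k} (hp : NilAt N p) (hq : NilAt N q) :
    NilAt N (p + q) := by
  induction N generalizing p q with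
  | zero => cases hp; cases hq; exact add_zero 0
  | succ N ih => intro w; rw [map_add]; exact ih (hp w) (hq w)

lemma NilAt.mul {N M : ℕ} {p q : MvPolynomial (Idx n) k} (hp : NilAt N p) (hq : NilAt M q) :
    NilAt (N + M) (p * q) := by
  induction hS : N + M generalizing N M p q with
  | zero =>
    obtain rfl : N = 0 := by omega
    cases hp; exact zero_mul q
  | succ S ih =>
    rcases N with _ | N
    · cases hp; rw [zero_mul]; exact NilAt.zero _
    rcases M with _ | M
    · cases hq; rw [mul_zero]; exact NilAt.zero _
    intro w
    rw [Derivation.leibniz, smul_eq_mul, smul_eq_mul, mul_comm q]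
    exact (ih hp (hq w) (by omega)).add (ih (hp w) hq (by omega))

lemma NilAt.C (a : k) : NilAt 1 (C a : MvPolynomial (Idx n) k) := by
  intro w
  rw [derivation_C]
  rfl

lemma NilAt.var {i j : ℕ} (hj : 1 ≤ j) (hij : i + j ≤ n + 1) :
    NilAt (i + 1) (var k n i j) := by
  induction i using Nat.strong_induction_on with
  | _ i ih =>
    intro w
    have hw := w.2
    rw [removeSuffix_var w hj hij]
    split_ifs with h
    · exact (ih (i - w.1.1) (by omega) (by omega)).mono (by omega)
    · exact NilAt.zero _

lemma exists_nilAt (p : MvPolynomial (Idx n) k) : ∃ N, NilAt N p := by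
  induction p using MvPolynomial.induction_on with
  | C a => exact ⟨1, NilAt.C a⟩
  | add p q hp hq =>
    obtain ⟨N, hN⟩ := hp
    obtain ⟨M, hM⟩ := hq
    exact ⟨max N M, (hN.mono (le_max_left _ _)).add (hM.mono (le_max_right _ _))⟩
  | mul_X p v hp =>
    obtain ⟨N, hN⟩ := hp
    have hv := NilAt.var (k := k) v.2.2.1 v.2.2.2
    rw [var_of_valid v.2] at hv
    exact ⟨_, hN.mul hv⟩

lemma pderiv_ne_zero_of_mem_vars {σ : Type*} [CharZero k] {p : MvPolynomial σ k} {w : σ}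
    (hw : w ∈ p.vars) : pderiv w p ≠ 0 := by
  intro h
  obtain ⟨m, hm, hwm⟩ := (mem_vars_iff_mem_support w).1 hw
  have hle : Finsupp.single w 1 ≤ m := by
    rw [Finsupp.single_le_iff]
    exact Nat.one_le_iff_ne_zero.2 (Finsupp.mem_support_iff.1 hwm)
  have hc := coeff_pderiv (i := w) p (m - Finsupp.single w 1)
  rw [h, coeff_zero, tsub_add_cancel_of_le hle] at hc
  refine mul_ne_zero (mem_support_iff.1 hm) ?_ hc.symm
  exact Nat.cast_add_one_ne_zero _

/-- A polynomial killed by all suffix removals is constant. -/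
lemma exists_eq_C_of_removeSuffix_eq_zero [CharZero k] {p : MvPolynomial (Idx n) k}
    (h : ∀ w, removeSuffix k w p = 0) : ∃ a, p = C a := by
  by_cases hp : p.vars.Nonempty
  · exfalso
    obtain ⟨w, hw, hmax⟩ := Finset.exists_max_image p.vars (fun v => v.1.1) hp
    refine pderiv_ne_zero_of_mem_vars hw ((derivation_eq_of_forall_mem_vars fun v hv => ?_).trans
      (h w))
    have hvw := hmax v hv
    rw [removeSuffix_X]
    split_ifs with hc
    · obtain rfl : v = w := Subtype.ext (Prod.ext (by omega) (by omega))
      simp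
    · exact pderiv_X_of_ne (by rintro rfl; exact hc ⟨le_rfl, rfl⟩)
  · exact ⟨_, vars_eq_empty_iff_eq_C.1 (Finset.not_nonempty_iff_eq_empty.1 hp)⟩

/-- A polynomial all of whose suffix removals are constant is affine in the variables
indexed by words of length one. -/
lemma eq_affine_of_removeSuffix_eq_C [CharZero k] {p : MvPolynomial (Idx n) k}
    (h : ∀ w : Idx n, w.1.1 = 1 → ∃ a, removeSuffix k w p = C a) :
    ∃ (c : ℕ → k) (g : k), (∀ w : Idx n, w.1.1 = 1 → removeSuffix k w p = C (c w.1.2)) ∧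
      p = ∑ j ∈ Finset.Icc 1 n, C (c j) * var k n 1 j + C g := by
  have hlong : ∀ l, ∀ w : Idx n, w.1.1 = l + 1 → ∃ a, removeSuffix k w p = C a ∧
      (l ≠ 0 → a = 0) := by
    intro l
    induction l with
    | zero =>
      intro w hw
      obtain ⟨a, ha⟩ := h w hw
      exact ⟨a, ha, by simp⟩
    | succ l ih =>
      intro w hw
      obtain ⟨a, ha⟩ := h (⟨(1, w.1.2), by have := w.2; simp only; omega⟩ : Idx n) rfl
      obtain ⟨b, hb, -⟩ := ih (⟨(w.1.1 - 1, w.1.2 + 1), by have := w.2; simp only; omega⟩ : Idx n)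
        (by simp only; omega)
      refine ⟨0, ?_, fun _ => rfl⟩
      rw [removeSuffix_eq_commutator w (by omega), Derivation.commutator_apply, ha, hb]
      simp
  have hex : ∀ j : ℕ, ∃ a : k, ∀ hj : 1 ≤ j ∧ j ≤ n,
      removeSuffix k (⟨(1, j), by simp only; omega⟩ : Idx n) p = C a := by
    intro j
    by_cases hj : 1 ≤ j ∧ j ≤ n
    · obtain ⟨a, ha⟩ := h (⟨(1, j), by simp only; omega⟩ : Idx n) rfl
      exact ⟨a, fun _ => ha⟩
    · exact ⟨0, fun hj' => absurd hj' hj⟩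
  choose c hc using hex
  have hc' : ∀ w : Idx n, w.1.1 = 1 → removeSuffix k w p = C (c w.1.2) := by
    rintro ⟨⟨i, j⟩, h1, h2, h3⟩ rfl
    exact hc j ⟨h2, by simp only at h3; omega⟩
  obtain ⟨g, hg⟩ := exists_eq_C_of_removeSuffix_eq_zero
    (p := p - ∑ j ∈ Finset.Icc 1 n, C (c j) * var k n 1 j) (by
      intro w
      have hw := w.2
      have hsum : removeSuffix k w (∑ j ∈ Finset.Icc 1 n, C (c j) * var k n 1 j) =
          if w.1.1 = 1 then C (c w.1.2) else 0 := by
        rw [map_sum]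
        have : ∀ j ∈ Finset.Icc 1 n, removeSuffix k w (C (c j) * var k n 1 j) =
            if j = w.1.2 then (if w.1.1 = 1 then C (c j) else 0) else 0 := by
          intro j hj
          rw [Finset.mem_Icc] at hj
          rw [Derivation.leibniz, derivation_C, smul_zero, add_zero,
            removeSuffix_var w hj.1 (by omega), smul_eq_mul]
          split_ifs <;> first | omega | simp_all
        rw [Finset.sum_congr rfl this, Finset.sum_ite_eq', if_pos]
        rw [Finset.mem_Icc]; omega
      rw [map_sub, hsum]
      split_ifs with h1
      · rw [hc' w h1, sub_self]
      · obtain ⟨a, ha, ha0⟩ := hlong (w.1.1 - 1) w (by omega)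
        rw [ha, ha0 (by omega), C_0, sub_zero])
  exact ⟨c, g, hc', by rw [← hg]; ring⟩

section Deriv

variable {f : ℕ → k} {d : Derivation ℤ (MvPolynomial (Idx n) k) (MvPolynomial (Idx n) k)}
  (hdC : ∀ a, ∃ b, d (C a) = C b)
  (hdX : ∀ w : Idx n, d (X w) = C (f w.1.2) * var k n (w.1.1 - 1) (w.1.2 + 1))

include hdC hdX

lemma removeSuffix_comm (w : Idx n) (p : MvPolynomial (Idx n) k) :
    removeSuffix k w (d p) = d (removeSuffix k w p) := by
  induction p using MvPolynomial.induction_on with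
  | C a =>
    obtain ⟨b, hb⟩ := hdC a
    rw [hb, derivation_C, derivation_C, map_zero]
  | add p q hp hq => simp only [map_add, hp, hq]
  | mul_X p v hp =>
    have hX : removeSuffix k w (d (X v)) = d (removeSuffix k w (X v)) := by
      have hv := v.2
      have hw := w.2
      rw [hdX, Derivation.leibniz, derivation_C, smul_zero, add_zero, removeSuffix_X, smul_eq_mul,
        removeSuffix_var w (by omega) (by omega)]
      by_cases h : w.1.1 ≤ v.1.1 ∧ v.1.1 + v.1.2 = w.1.1 + w.1.2
      · rw [if_pos h]
        by_cases h' : w.1.1 = v.1.1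
        · rw [if_neg (by omega), h', Nat.sub_self, var_zero, Derivation.map_one_eq_zero, mul_zero]
        · rw [if_pos (by omega), var_of_valid (i := v.1.1 - w.1.1) (by omega), hdX]
          simp only
          congr 2
          omega
      · rw [if_neg h, if_neg (by omega), map_zero, mul_zero]
    simp only [Derivation.leibniz, map_add, smul_eq_mul, hp, hX]
    ring

lemma totalDegree_deriv_le (p : MvPolynomial (Idx n) k) :
    (d p).totalDegree ≤ p.totalDegree := by
  have hvar : ∀ i j, (var k n i j).totalDegree ≤ 1 := by
    intro i j
    unfold var
    split_ifs <;> simp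
  have hmon : ∀ m a, (d (monomial m a)).totalDegree ≤ (monomial m a).totalDegree := by
    refine induction_on_monomial (fun a => ?_) fun p v hp => ?_
    · obtain ⟨b, hb⟩ := hdC a
      simp [hb]
    · by_cases hp0 : p = 0
      · simp [hp0]
      rw [totalDegree_mul_of_isDomain hp0 (X_ne_zero v), totalDegree_X, Derivation.leibniz,
        smul_eq_mul, smul_eq_mul, hdX]
      refine (totalDegree_add _ _).trans (max_le ?_ ?_)
      · refine (totalDegree_mul _ _).trans (Nat.add_le_add_left ?_ _)
        refine (totalDegree_mul _ _).trans ?_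
        simpa using hvar _ _
      · refine (totalDegree_mul _ _).trans ?_
        rw [totalDegree_X]
        omega
  conv_lhs => rw [p.as_sum, map_sum]
  refine totalDegree_finsetSum_le fun m hm => (hmon m _).trans ?_
  exact (totalDegree_monomial_le _ _).trans (le_totalDegree hm)

/-- The eigenvalue of a polynomial eigenvector of `d` is a logarithmic derivative. -/
lemma exists_eigenvector_C [CharZero k] {l : k} {N : ℕ} {q : MvPolynomial (Idx n) k}
    (hN : NilAt N q) (hq0 : q ≠ 0) (hq : d q = C l * q) :
    ∃ a ≠ 0, d (C a) = C l * C a := by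
  induction N generalizing q with
  | zero => exact absurd hN hq0
  | succ N ih =>
    by_cases h : ∀ w, removeSuffix k w q = 0
    · obtain ⟨a, rfl⟩ := exists_eq_C_of_removeSuffix_eq_zero h
      exact ⟨a, fun ha => hq0 (by rw [ha, C_0]), hq⟩
    · push Not at h
      obtain ⟨w, hw⟩ := h
      refine ih (hN w) hw ?_
      rw [← removeSuffix_comm hdC hdX, hq, Derivation.leibniz, derivation_C, smul_zero, add_zero,
        smul_eq_mul]

variable (hcond : ∀ (c : ℕ → k) (g : k),
  (∀ j, 1 ≤ j → j ≤ n → d (C (c j)) = 0) → C (∑ j ∈ Finset.Icc 1 n, c j * f j) = d (C g) →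
    ∀ j, 1 ≤ j → j ≤ n → c j = 0)

include hcond

lemma exists_eq_C_of_deriv_eq_zero [CharZero k] {N : ℕ} {q : MvPolynomial (Idx n) k}
    (hN : NilAt N q) (hq : d q = 0) : ∃ a, q = C a := by
  induction N generalizing q with
  | zero => exact ⟨0, by rw [C_0]; exact hN⟩
  | succ N ih =>
    have hw : ∀ w, d (removeSuffix k w q) = 0 := fun w => by
      rw [← removeSuffix_comm hdC hdX, hq, map_zero]
    obtain ⟨c, g, hc, hqc⟩ := eq_affine_of_removeSuffix_eq_C fun w _ => ih (hN w) (hw w)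
    have hc0 : ∀ j, 1 ≤ j → j ≤ n → d (C (c j)) = 0 := by
      intro j hj hjn
      have := hc (⟨(1, j), by simp only; omega⟩ : Idx n) rfl
      rw [← this, hw]
    have hsum : ∀ j ∈ Finset.Icc 1 n, d (C (c j) * var k n 1 j) = C (c j * f j) := by
      intro j hj
      rw [Finset.mem_Icc] at hj
      rw [Derivation.leibniz, hc0 j hj.1 hj.2, smul_zero, add_zero, var_of_valid (by omega), hdX]
      simp
    have hzero := hcond (fun j => -c j) g (fun j hj hjn => by rw [C_neg, map_neg, hc0 j hj hjn,
      neg_zero]) (by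
        have h := hq
        rw [hqc, map_add, map_sum, Finset.sum_congr rfl hsum, ← map_sum] at h
        rw [← neg_eq_of_add_eq_zero_right h]
        simp)
    refine ⟨g, hqc.trans ?_⟩
    rw [Finset.sum_eq_zero, zero_add]
    intro j hj
    rw [Finset.mem_Icc] at hj
    rw [neg_eq_zero.1 (hzero j hj.1 hj.2), C_0, zero_mul]

/-- A nonzero polynomial dividing its derivative is constant. -/
lemma exists_eq_C_of_dvd_deriv [CharZero k] {q : MvPolynomial (Idx n) k} (hq0 : q ≠ 0)
    (hq : q ∣ d q) : ∃ a, q = C a := by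
  obtain ⟨h, hh⟩ := hq
  obtain ⟨N, hN⟩ := exists_nilAt q
  have hhC : ∃ l, h = C l := by
    by_cases h0 : h = 0
    · exact ⟨0, by rw [h0, C_0]⟩
    · have hdeg := totalDegree_deriv_le hdC hdX q
      rw [hh, totalDegree_mul_of_isDomain hq0 h0] at hdeg
      exact ⟨_, totalDegree_eq_zero_iff_eq_C.1 (by omega)⟩
  obtain ⟨l, rfl⟩ := hhC
  obtain ⟨a, ha0, ha⟩ := exists_eigenvector_C hdC hdX hN hq0 (hh.trans (mul_comm _ _))
  have hinv : C a * C a⁻¹ = (1 : MvPolynomial (Idx n) k) := by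
    rw [← C_mul, mul_inv_cancel₀ ha0, C_1]
  have hdinv : d (C a⁻¹) = - (C l * C a⁻¹) := by
    have h1 := congrArg d hinv
    rw [Derivation.leibniz, Derivation.map_one_eq_zero, ha, smul_eq_mul, smul_eq_mul] at h1
    linear_combination C a⁻¹ * h1 - (d (C a⁻¹) + C l * C a⁻¹) * hinv
  obtain ⟨M, hM⟩ := exists_nilAt (C a⁻¹ * q)
  obtain ⟨b, hb⟩ := exists_eq_C_of_deriv_eq_zero hdC hdX hcond hM (by
    rw [Derivation.leibniz, hh, hdinv, smul_eq_mul, smul_eq_mul]; ring)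
  exact ⟨a * b, by rw [C_mul, ← hb, ← mul_assoc, hinv, one_mul]⟩

lemma eq_affine_of_deriv_eq_C [CharZero k] {p : MvPolynomial (Idx n) k} {a : k}
    (hp : d p = C a) : ∃ (c : ℕ → k) (g : k), (∀ j, 1 ≤ j → j ≤ n → d (C (c j)) = 0) ∧
      p = ∑ j ∈ Finset.Icc 1 n, C (c j) * var k n 1 j + C g := by
  have hw : ∀ w, d (removeSuffix k w p) = 0 := fun w => by
    rw [← removeSuffix_comm hdC hdX, hp, derivation_C]
  obtain ⟨c, g, hc, hpc⟩ := eq_affine_of_removeSuffix_eq_C (p := p) fun w _ => by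
    obtain ⟨N, hN⟩ := exists_nilAt (removeSuffix k w p)
    exact exists_eq_C_of_deriv_eq_zero hdC hdX hcond hN (hw w)
  refine ⟨c, g, fun j hj hjn => ?_, hpc⟩
  have := hc (⟨(1, j), by simp only; omega⟩ : Idx n) rfl
  rw [← this, hw]

end Deriv

/-- A derivation that maps the image of an injective ring homomorphism to itself restricts to
its domain. -/
lemma exists_restrict_derivation {R A : Type*} [CommRing R] [CommRing A] [Algebra ℚ A]
    (φ : R →+* A) (hφ : Function.Injective φ) (D : Derivation ℚ A A)
    (hD : ∀ p, ∃ q, φ q = D (φ p)) :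
    ∃ d : Derivation ℤ R R, ∀ p, φ (d p) = D (φ p) := by
  choose d hd using hD
  let dAdd : R →+ R := AddMonoidHom.mk' d fun p q => hφ (by simp only [hd, map_add])
  refine ⟨Derivation.mk' dAdd.toIntLinearMap fun p q => hφ ?_, hd⟩
  change φ (d (p * q)) = φ (p • d q + q • d p)
  simp only [hd, map_mul, map_add, Derivation.leibniz, smul_eq_mul]

lemma diffAdjoin_singleton_le {E : Type} [Field E] [CharZero E] {D : Derivation ℚ E E}
    {F : Subfield E} (hF : ∀ a ∈ F, D a ∈ F) {y : E} (hy : D y ∈ F) :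
    diffAdjoin E D F {y} ≤ Subfield.closure (↑F ∪ {y}) := by
  have hFK : F ≤ Subfield.closure (↑F ∪ {y}) := fun a ha => Subfield.subset_closure (Or.inl ha)
  refine sInf_le ⟨hFK, fun a ha => Subfield.subset_closure (Or.inr ha), fun a ha => ?_⟩
  induction ha using Subfield.closure_induction with
  | mem a ha =>
    rcases ha with ha | rfl
    · exact hFK (hF a ha)
    · exact hFK hy
  | one => rw [Derivation.map_one_eq_zero]; exact zero_mem _
  | add a b _ _ ha hb => rw [map_add]; exact add_mem ha hb
  | neg a _ ha => rw [map_neg]; exact neg_mem ha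
  | inv a ha' ha =>
    rw [Derivation.leibniz_inv]
    exact mul_mem (neg_mem (pow_mem (inv_mem ha') 2)) ha
  | mul a b ha' hb' ha hb =>
    rw [Derivation.leibniz]
    exact add_mem (mul_mem ha' hb) (mul_mem hb' ha)

lemma aeval_var {E : Type} [Field E] {F : Subfield E} {x : ℕ → ℕ → E} {i j : ℕ}
    (h : 1 ≤ i ∧ 1 ≤ j ∧ i + j ≤ n + 1) :
    aeval (fun p : Idx n => x p.1.1 p.1.2) (var F n i j) = x i j := by
  rw [var_of_valid h, aeval_X]

/-- Every element of `F(y s : s ∈ S)` is a quotient of polynomials in the `y s`. -/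
lemma exists_aeval_div {σ E : Type*} [Field E] {F : Subfield E} (y : σ → E) (S : Set σ) {a : E}
    (ha : a ∈ Subfield.closure (↑F ∪ y '' S)) :
    ∃ p ∈ supported F S, ∃ q ∈ supported F S, a = aeval y p / aeval y q := by
  have hle : Subring.closure (↑F ∪ y '' S) ≤
      ((supported F S).toSubring.map (aeval y : MvPolynomial σ F →ₐ[F] E).toRingHom) := by
    rw [Subring.closure_le]
    rintro b (hb | ⟨s, hs, rfl⟩)
    · exact ⟨C ⟨b, hb⟩, Subalgebra.algebraMap_mem _ _, aeval_C _ _⟩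
    · exact ⟨X s, X_mem_supported.2 hs, aeval_X _ _⟩
  obtain ⟨u, hu, v, hv, rfl⟩ := Subfield.mem_closure_iff.1 ha
  obtain ⟨p, hp, rfl⟩ := hle hu
  obtain ⟨q, hq, rfl⟩ := hle hv
  exact ⟨p, hp, q, hq, rfl⟩

end IteratedIntegral

open IteratedIntegral MvPolynomial in
/-- In the extension `E = F(x_{i,j})` built from `f₁, …, fₙ`
satisfying condition (C), every `x` in `N = F⟨x_{n,1}⟩(x_{1,1}, …, x_{1,n})` with
`x′ ∈ F` has the form `x = Σ cᵢ·x_{1,i} + f` with the `cᵢ` constants of `F` and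
`f ∈ F`; moreover if `x ∈ F⟨x_{1,n}⟩` then `cᵢ = 0` for all `i ≤ n − 1`. -/
theorem antiderivatives_in_N
    (E : Type) [Field E] [CharZero E] (D : Derivation ℚ E E)
    (F : Subfield E) (hF : ∀ a ∈ F, D a ∈ F)
    (n : ℕ) (f : ℕ → E) (hf : ∀ j, 1 ≤ j → j ≤ n → f j ∈ F)
    (hcondC : ∀ (c : ℕ → E) (g : E),
      (∀ j, 1 ≤ j → j ≤ n → c j ∈ F ∧ D (c j) = 0) → g ∈ F →
      (∑ j ∈ Finset.Icc 1 n, c j * f j) = D g → ∀ j, 1 ≤ j → j ≤ n → c j = 0)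
    (x : ℕ → ℕ → E)
    (hind : AlgebraicIndependent F
      (fun p : {p : ℕ × ℕ // 1 ≤ p.1 ∧ 1 ≤ p.2 ∧ p.1 + p.2 ≤ n + 1} => x p.1.1 p.1.2))
    (hgen : Subfield.closure
      (↑F ∪ {a | ∃ i j, 1 ≤ i ∧ 1 ≤ j ∧ i + j ≤ n + 1 ∧ a = x i j}) = ⊤)
    (hd1 : ∀ j, 1 ≤ j → j ≤ n → D (x 1 j) = f j)
    (hdi : ∀ i j, 2 ≤ i → 1 ≤ j → i + j ≤ n + 1 → D (x i j) = f j * x (i - 1) (j + 1)) :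
    ∀ ξ : E,
      ξ ∈ Subfield.closure
        (↑(diffAdjoin E D F {x n 1}) ∪ {a | ∃ j, 1 ≤ j ∧ j ≤ n ∧ a = x 1 j}) →
      D ξ ∈ F →
      ∃ (c : ℕ → E) (g : E),
        (∀ i, 1 ≤ i → i ≤ n → c i ∈ F ∧ D (c i) = 0) ∧ g ∈ F ∧
        ξ = (∑ i ∈ Finset.Icc 1 n, c i * x 1 i) + g ∧
        (ξ ∈ diffAdjoin E D F {x 1 n} → ∀ i, 1 ≤ i → i ≤ n - 1 → c i = 0) := by
  intro ξ _ hξ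
  have hφ : Function.Injective (aeval (R := F) fun p : Idx n => x p.1.1 p.1.2) := hind
  set φ := aeval (R := F) fun p : Idx n => x p.1.1 p.1.2 with hφdef
  have hφC : ∀ a : F, φ (C a) = a := fun a => aeval_C _ _
  let f' : ℕ → F := fun j => if h : 1 ≤ j ∧ j ≤ n then ⟨f j, hf j h.1 h.2⟩ else 0
  have hf' : ∀ j, 1 ≤ j → j ≤ n → (f' j : E) = f j := fun j h1 h2 => by simp [f', h1, h2]
  have hDX : ∀ w : Idx n, φ (C (f' w.1.2) * var F n (w.1.1 - 1) (w.1.2 + 1)) = D (φ (X w)) := by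
    rintro ⟨⟨i, j⟩, h1, h2, h3⟩
    simp only at h1 h2 h3 ⊢
    rw [map_mul, hφC, hf' j h2 (by omega), hφdef, aeval_X]
    rcases Nat.lt_or_ge 1 i with hi | hi
    · rw [hdi i j hi h2 h3, aeval_var (by omega)]
    · obtain rfl : i = 1 := by omega
      rw [hd1 j h2 (by omega)]
      simp
  obtain ⟨d, hd⟩ := exists_restrict_derivation φ.toRingHom hφ D (by
    intro p
    induction p using MvPolynomial.induction_on with
    | C a => exact ⟨C ⟨D a, hF a a.2⟩, (hφC _).trans (congrArg D (hφC a).symm)⟩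
    | add p q hp hq =>
      obtain ⟨p', hp'⟩ := hp
      obtain ⟨q', hq'⟩ := hq
      exact ⟨p' + q', by simp only [map_add, hp', hq']⟩
    | mul_X p w hp =>
      obtain ⟨p', hp'⟩ := hp
      refine ⟨p * (C (f' w.1.2) * var F n (w.1.1 - 1) (w.1.2 + 1)) + X w * p', ?_⟩
      rw [map_add, map_mul _ (X w), hp', map_mul _ p, map_mul _ p, Derivation.leibniz,
        smul_eq_mul, smul_eq_mul]
      exact congrArg₂ _ (congrArg₂ _ rfl (hDX w)) rfl)
  replace hd : ∀ p, φ (d p) = D (φ p) := hd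
  have hdC : ∀ a : F, ∃ b, d (C a) = C b := fun a =>
    ⟨⟨D a, hF a a.2⟩, hφ (by rw [hd, hφC, hφC])⟩
  have hdX : ∀ w : Idx n, d (X w) = C (f' w.1.2) * var F n (w.1.1 - 1) (w.1.2 + 1) :=
    fun w => hφ (by rw [hd, hDX])
  have hconst : ∀ a : F, d (C a) = 0 ↔ D (a : E) = 0 := fun a => by
    rw [← hφ.eq_iff, hd, hφC, map_zero]
  have hcond : ∀ (c : ℕ → F) (g : F), (∀ j, 1 ≤ j → j ≤ n → d (C (c j)) = 0) →
      C (∑ j ∈ Finset.Icc 1 n, c j * f' j) = d (C g) → ∀ j, 1 ≤ j → j ≤ n → c j = 0 := by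
    intro c g hc hsum j hj hjn
    refine Subtype.ext (hcondC (fun j => c j) g
      (fun j hj hjn => ⟨(c j).2, (hconst _).1 (hc j hj hjn)⟩) g.2 ?_ j hj hjn)
    have h := congrArg φ hsum
    rw [hd, hφC, hφC] at h
    rw [← h, AddSubmonoidClass.coe_finsetSum]
    refine Finset.sum_congr rfl fun j hj => ?_
    rw [Finset.mem_Icc] at hj
    rw [← hf' j hj.1 hj.2]
    rfl
  have hpoly : ∃ p, φ p = ξ := by
    obtain ⟨P, -, Q, -, hPQ⟩ := exists_aeval_div (F := F)
      (fun p : Idx n => x p.1.1 p.1.2) Set.univ (a := ξ) (by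
        have htop : ξ ∈ (⊤ : Subfield E) := trivial
        rw [← hgen] at htop
        refine Subfield.closure_mono (Set.union_subset_union_right _ ?_) htop
        rintro _ ⟨i, j, h1, h2, h3, rfl⟩
        exact ⟨⟨(i, j), h1, h2, h3⟩, trivial, rfl⟩)
    change ξ = φ P / φ Q at hPQ
    by_cases hQ : Q = 0
    · exact ⟨0, by simp [hPQ, hQ]⟩
    obtain ⟨q, p, r, hrel, rfl, rfl⟩ := UniqueFactorizationMonoid.exists_reduced_factors Q hQ P
    have hr : φ r ≠ 0 := (map_ne_zero_iff φ hφ).2 (left_ne_zero_of_mul hQ)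
    have hq0 : q ≠ 0 := right_ne_zero_of_mul hQ
    have hq : φ q ≠ 0 := (map_ne_zero_iff φ hφ).2 hq0
    rw [map_mul, map_mul, mul_div_mul_left _ _ hr, eq_div_iff hq] at hPQ
    have hmul : q * d p = q * q * C ⟨D ξ, hξ⟩ + p * d q := hφ (by
      have h := congrArg D hPQ
      rw [Derivation.leibniz, smul_eq_mul, smul_eq_mul, ← hd, ← hd] at h
      simp only [map_add, map_mul, hφC]
      rw [← h, ← hPQ]
      ring)
    have hdvd : q ∣ p * d q := by
      rw [← sub_eq_iff_eq_add'.2 hmul]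
      exact dvd_sub (Dvd.intro _ rfl) (Dvd.intro _ (mul_assoc _ _ _).symm)
    obtain ⟨e, rfl⟩ := exists_eq_C_of_dvd_deriv hdC hdX hcond hq0 (hrel.dvd_of_dvd_mul_left hdvd)
    refine ⟨C e⁻¹ * p, ?_⟩
    rw [hφC] at hPQ hq
    rw [map_mul, hφC, ← hPQ, Subfield.coe_inv]
    field_simp
  obtain ⟨p, rfl⟩ := hpoly
  obtain ⟨c, g, hc, hp⟩ := eq_affine_of_deriv_eq_C hdC hdX hcond (p := p) (a := ⟨_, hξ⟩)
    (hφ ((hd p).trans (hφC ⟨_, hξ⟩).symm))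
  have hφvar : ∀ j ∈ Finset.Icc 1 n, φ (C (c j) * var F n 1 j) = c j * x 1 j := by
    intro j hj
    rw [Finset.mem_Icc] at hj
    rw [map_mul, hφC, hφdef, aeval_var (by omega)]
  refine ⟨fun j => c j, g, fun j hj hjn => ⟨(c j).2, (hconst _).1 (hc j hj hjn)⟩, g.2, ?_, ?_⟩
  · rw [hp, map_add, map_sum, Finset.sum_congr rfl hφvar, hφC]
  · intro hmem i hi hin
    let w : Idx n := ⟨(1, n), by simp only; omega⟩
    let v : Idx n := ⟨(1, i), by simp only; omega⟩
    have hvw : v ≠ w := fun h => by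
      have : i = n := congrArg (fun u : Idx n => u.1.2) h
      omega
    have hcl := diffAdjoin_singleton_le hF
      (by rw [hd1 n (by omega) le_rfl]; exact hf n (by omega) le_rfl) hmem
    obtain ⟨A, hA, B, hB, hAB⟩ := exists_aeval_div (F := F)
      (fun p : Idx n => x p.1.1 p.1.2) {w} (by rwa [Set.image_singleton])
    change φ p = φ A / φ B at hAB
    have hpd : ∀ u ∈ supported F {w}, pderiv v u = 0 := fun u hu =>
      pderiv_eq_zero_of_notMem_vars fun hv => hvw (mem_supported.1 hu hv)
    have hpv : pderiv v p = C (c i) := by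
      rw [hp, map_add, pderiv_C, add_zero, map_sum, Finset.sum_eq_single i]
      · rw [pderiv_C_mul, var_of_valid v.2, pderiv_X_self, mul_one]
      · intro j hj hji
        rw [Finset.mem_Icc] at hj
        rw [pderiv_C_mul, var_of_valid (by omega), pderiv_X_of_ne, mul_zero]
        exact fun h => hji (congrArg (fun u : Idx n => u.1.2) h)
      · exact fun h => absurd (Finset.mem_Icc.2 ⟨hi, by omega⟩) h
    suffices hci : (C (c i) : MvPolynomial (Idx n) F) = 0 by
      rw [C_eq_zero] at hci
      exact congrArg Subtype.val hci
    by_cases hB0 : B = 0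
    · rw [hB0, map_zero, div_zero, map_eq_zero_iff φ hφ] at hAB
      rw [← hpv, hAB, map_zero]
    · rw [eq_div_iff ((map_ne_zero_iff φ hφ).2 hB0), ← map_mul] at hAB
      have h := congrArg (pderiv v) (hφ hAB)
      rw [pderiv_mul, hpv, hpd A hA, hpd B hB, mul_zero, add_zero] at h
      exact (mul_eq_zero.1 h).resolve_right hB0
end
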